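/- Let (X_t)_{t∈ℝ^l} be an ℝ^d-valued strictly stationary infinitely divisible random field on a probability space (Ω, ℱ, P). Then (X_t)_{t∈ℝ^l} is mixing if and only if for every sequence (t_n)_{n∈ℕ} ⊆ ℝ^l with ‖t_n‖_∞ → ∞, the law of X_{t_n} − X_0 converges weakly to the law of X_0 − X_0', where X_0' is an independent copy of X_0. -/

import Mathlib

open MeasureTheory Filter ProbabilityTheory
open scoped MeasureTheory

noncomputable section

/-- The `n`-fold convolution power of a measure. -/
def convPow {E : Type*} [MeasurableSpace E] [AddMonoid E] (ν : Measure E) : ℕ → Measure E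
  | 0 => Measure.dirac 0
  | n + 1 => (convPow ν n) ∗ ν

/-- A probability measure is infinitely divisible if every `n ≥ 1` admits an `n`-th
convolution root. -/
def IsInfDiv {E : Type*} [MeasurableSpace E] [AddMonoid E] (μ : Measure E) : Prop :=
  ∀ n : ℕ, 1 ≤ n → ∃ ν : Measure E, IsProbabilityMeasure ν ∧ convPow ν n = μ

/-- A random field is strictly stationary: all finite-dimensional distributions are
invariant under a common shift of the indices. -/
def IsStationaryField {Ω : Type*} [MeasurableSpace Ω] {l d : ℕ} (P : Measure Ω)
    (X : (Fin l → ℝ) → Ω → (Fin d → ℝ)) : Prop :=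
  ∀ (h : Fin l → ℝ) (m : ℕ) (t : Fin m → (Fin l → ℝ)),
    P.map (fun ω (j : Fin m) => X (t j + h) ω) = P.map (fun ω (j : Fin m) => X (t j) ω)

/-- All finite-dimensional distributions of the field are infinitely divisible. -/
def IsIDField {Ω : Type*} [MeasurableSpace Ω] {l d : ℕ} (P : Measure Ω)
    (X : (Fin l → ℝ) → Ω → (Fin d → ℝ)) : Prop :=
  ∀ (m : ℕ) (t : Fin m → (Fin l → ℝ)),
    IsInfDiv (P.map (fun ω (j : Fin m) => X (t j) ω))

/-- The random field is mixing (characteristic-function formulation); the norm on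
`Fin l → ℝ` is the sup norm. -/
def IsMixingField {Ω : Type*} [MeasurableSpace Ω] {l d : ℕ} (P : Measure Ω)
    (X : (Fin l → ℝ) → Ω → (Fin d → ℝ)) : Prop :=
  ∀ (m : ℕ) (s p : Fin m → (Fin l → ℝ)) (θ₁ θ₂ : Fin m → Fin d → ℝ)
    (t : ℕ → (Fin l → ℝ)), Tendsto (fun n => ‖t n‖) atTop atTop →
    Tendsto (fun n => ∫ ω, Complex.exp (Complex.I *
        (((∑ j, ∑ k, θ₁ j k * X (s j) ω k) + ∑ j, ∑ k, θ₂ j k * X (p j + t n) ω k : ℝ) : ℂ)) ∂P)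
      atTop (nhds
        ((∫ ω, Complex.exp (Complex.I * ((∑ j, ∑ k, θ₁ j k * X (s j) ω k : ℝ) : ℂ)) ∂P) *
         (∫ ω, Complex.exp (Complex.I * ((∑ j, ∑ k, θ₂ j k * X (p j) ω k : ℝ) : ℂ)) ∂P)))

/-- A subset of `ℝ^l` has density one w.r.t. Lebesgue measure. -/
def HasDensityOne {l : ℕ} (D : Set (Fin l → ℝ)) : Prop :=
  Tendsto (fun T : ℝ => ((2 * T) ^ l)⁻¹ *
      ∫ x in Set.univ.pi (fun _ : Fin l => Set.Ioc (-T) T),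
        Set.indicator Dᶜ (fun _ => (1 : ℝ)) x)
    atTop (nhds 0)

/-- The random field is weakly mixing (characteristic-function formulation along a
density-one set). -/
def IsWeaklyMixingField {Ω : Type*} [MeasurableSpace Ω] {l d : ℕ} (P : Measure Ω)
    (X : (Fin l → ℝ) → Ω → (Fin d → ℝ)) : Prop :=
  ∃ D : Set (Fin l → ℝ), HasDensityOne D ∧
    ∀ (m : ℕ) (s p : Fin m → (Fin l → ℝ)) (θ₁ θ₂ : Fin m → Fin d → ℝ)
      (t : ℕ → (Fin l → ℝ)), (∀ n, t n ∈ D) → Tendsto (fun n => ‖t n‖) atTop atTop →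
      Tendsto (fun n => ∫ ω, Complex.exp (Complex.I *
          (((∑ j, ∑ k, θ₁ j k * X (s j) ω k) + ∑ j, ∑ k, θ₂ j k * X (p j + t n) ω k : ℝ) : ℂ)) ∂P)
        atTop (nhds
          ((∫ ω, Complex.exp (Complex.I * ((∑ j, ∑ k, θ₁ j k * X (s j) ω k : ℝ) : ℂ)) ∂P) *
           (∫ ω, Complex.exp (Complex.I * ((∑ j, ∑ k, θ₂ j k * X (p j) ω k : ℝ) : ℂ)) ∂P)))

section

open Complex Set Topology

theorem norm_pow_sub_pow_le_of_norm_le_one {x y : ℂ} (hx : ‖x‖ ≤ 1) (hy : ‖y‖ ≤ 1) (n : ℕ) :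
    ‖x ^ n - y ^ n‖ ≤ n * ‖x - y‖ := by
  induction n with
  | zero => simp
  | succ n ih =>
    have h : x ^ (n + 1) - y ^ (n + 1) = (x ^ n - y ^ n) * x + y ^ n * (x - y) := by ring
    have h1 : ‖(x ^ n - y ^ n) * x‖ ≤ n * ‖x - y‖ := by
      rw [norm_mul]
      exact (mul_le_of_le_one_right (norm_nonneg _) hx).trans ih
    have h2 : ‖y ^ n * (x - y)‖ ≤ ‖x - y‖ := by
      rw [norm_mul, norm_pow]
      exact mul_le_of_le_one_left (norm_nonneg _) (pow_le_one₀ (norm_nonneg _) hy)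
    rw [h]
    refine (norm_add_le _ _).trans ?_
    push_cast
    linarith

/-- Two continuous `n`-th roots of the same nonvanishing function on a preconnected set agree
as soon as they agree at one point. -/
theorem IsPreconnected.eqOn_of_pow_eq {X : Type*} [TopologicalSpace X] {S : Set X}
    (hS : IsPreconnected S) {n : ℕ} (hn : n ≠ 0) {f g : X → ℂ} (hf : ContinuousOn f S)
    (hg : ContinuousOn g S) (hfg : ∀ x ∈ S, f x ^ n = g x ^ n) (hg0 : ∀ x ∈ S, g x ≠ 0)
    {x₀ : X} (hx₀ : x₀ ∈ S) (h₀ : f x₀ = g x₀) : EqOn f g S := by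
  have hfin : {z : ℂ | z ^ n = 1}.Finite := by
    refine (Polynomial.nthRoots n (1 : ℂ)).toFinset.finite_toSet.subset fun z hz => ?_
    simpa [Polynomial.mem_nthRoots (Nat.pos_of_ne_zero hn)] using hz
  intro x hx
  have h := hS.constant_of_mapsTo hfin.isDiscrete (hf.div hg hg0)
    (fun y hy => by
      have := pow_ne_zero n (hg0 y hy)
      simp [div_pow, hfg y hy, div_self this]) hx hx₀
  simp only [Pi.div_apply, h₀, div_self (hg0 x₀ hx₀)] at h
  exact (div_eq_one_iff_eq (hg0 x hx)).1 h

/-- If `ψ k → ψ₀` uniformly on `[0, 1]` and `ψ₀` does not vanish there, then continuous `n`-th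
roots `r k` of `ψ k` and `q k` of `ψ₀`, normalised at `0`, get close to each other. -/
theorem tendsto_sub_of_pow_eq {ψ r q : ℕ → ℝ → ℂ} {ψ₀ : ℝ → ℂ} {n : ℕ} (hn : n ≠ 0)
    (hψ₀ : ContinuousOn ψ₀ (Icc 0 1)) (hne : ∀ τ ∈ Icc (0 : ℝ) 1, ψ₀ τ ≠ 0)
    (hunif : ∀ ε > 0, ∀ᶠ k in atTop, ∀ τ ∈ Icc (0 : ℝ) 1, ‖ψ k τ - ψ₀ τ‖ < ε)
    (hrc : ∀ k, ContinuousOn (r k) (Icc 0 1)) (hqc : ∀ k, ContinuousOn (q k) (Icc 0 1))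
    (hr : ∀ k τ, r k τ ^ n = ψ k τ) (hq : ∀ k τ, q k τ ^ n = ψ₀ τ)
    (h₀ : ∀ k, r k 0 = q k 0) (hq1 : ∀ k, ‖q k 1‖ ≤ 1) :
    Tendsto (fun k => ‖r k 1 - q k 1‖) atTop (𝓝 0) := by
  have h01 : (0 : ℝ) ∈ Icc (0 : ℝ) 1 := by simp
  have h11 : (1 : ℝ) ∈ Icc (0 : ℝ) 1 := by simp
  obtain ⟨τ₀, hτ₀, hmin⟩ := isCompact_Icc.exists_isMinOn ⟨(0 : ℝ), h01⟩ hψ₀.norm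
  set c := ‖ψ₀ τ₀‖ with hc
  have hcpos : 0 < c := norm_pos_iff.2 (hne _ hτ₀)
  have hcle : ∀ τ ∈ Icc (0 : ℝ) 1, c ≤ ‖ψ₀ τ‖ := fun τ hτ => hmin hτ
  have hψ1 : Tendsto (fun k => ψ k 1) atTop (𝓝 (ψ₀ 1)) := by
    rw [tendsto_iff_norm_sub_tendsto_zero, Metric.tendsto_nhds]
    intro ε hε
    filter_upwards [hunif ε hε] with k hk
    simpa using hk 1 h11
  have hlim : Tendsto (fun k => ‖cexp (log (ψ k 1 / ψ₀ 1) / n) - 1‖) atTop (𝓝 0) := by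
    have h1 : Tendsto (fun k => ψ k 1 / ψ₀ 1) atTop (𝓝 1) := by
      simpa [div_self (hne 1 h11)] using hψ1.div_const (ψ₀ 1)
    have h2 := (continuousAt_clog (x := 1) (by simp)).tendsto.comp h1
    have h3 := (continuous_exp.tendsto _).comp (h2.div_const (n : ℂ))
    have h4 := (h3.sub_const 1).norm
    simpa using h4
  refine squeeze_zero' (Eventually.of_forall fun _ => norm_nonneg _) ?_ hlim
  filter_upwards [hunif c hcpos] with k hk
  have hqne : ∀ τ ∈ Icc (0 : ℝ) 1, q k τ ≠ 0 := by
    intro τ hτ h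
    apply hne τ hτ
    rw [← hq k τ, h, zero_pow hn]
  have hψc : ContinuousOn (ψ k) (Icc 0 1) := ((hrc k).pow n).congr fun τ _ => (hr k τ).symm
  have hslit : ∀ τ ∈ Icc (0 : ℝ) 1, ψ k τ / ψ₀ τ ∈ slitPlane := by
    intro τ hτ
    apply ball_one_subset_slitPlane
    have hne' := hne τ hτ
    rw [mem_ball_iff_norm, div_sub_one hne', norm_div, div_lt_one (norm_pos_iff.2 hne')]
    exact (hk τ hτ).trans_le (hcle τ hτ)
  have hwc : ContinuousOn (fun τ => ψ k τ / ψ₀ τ) (Icc 0 1) := hψc.div hψ₀ hne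
  have hroot : r k 1 / q k 1 = cexp (log (ψ k 1 / ψ₀ 1) / n) := by
    refine isPreconnected_Icc.eqOn_of_pow_eq hn (f := fun τ => r k τ / q k τ)
      (g := fun τ => cexp (log (ψ k τ / ψ₀ τ) / n)) ((hrc k).div (hqc k) hqne)
      (((hwc.clog hslit).div_const _).cexp) (fun τ hτ => ?_) (fun _ _ => exp_ne_zero _) h01 ?_ h11
    · have hn' : (n : ℂ) ≠ 0 := Nat.cast_ne_zero.2 hn
      rw [div_pow, hr, hq, ← exp_nat_mul, mul_div_cancel₀ _ hn',
        exp_log (slitPlane_ne_zero (hslit τ hτ))]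
    · have : ψ k 0 = ψ₀ 0 := by rw [← hr, ← hq k, h₀]
      simp [this, h₀, div_self (hqne 0 h01), div_self (hne 0 h01)]
  rw [← hroot, div_sub_one (hqne 1 h11), norm_div]
  exact le_div_self (norm_nonneg _) (norm_pos_iff.2 (hqne 1 h11)) (hq1 k)

/-- The characteristic function at `1` of the real random variable `A` under `ν`. -/
def expChar {Ω : Type*} [MeasurableSpace Ω] (ν : Measure Ω) (A : Ω → ℝ) : ℂ :=
  ∫ ω, cexp (A ω * I) ∂ν

section expChar

variable {Ω : Type*} [MeasurableSpace Ω] {ν : Measure Ω} {A B : Ω → ℝ}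

theorem integrable_cexp_mul_I [IsFiniteMeasure ν] (hA : Measurable A) :
    Integrable (fun ω => cexp (A ω * I)) ν :=
  (integrable_const (1 : ℝ)).mono (by fun_prop) (by simp [norm_exp_ofReal_mul_I])

theorem norm_expChar_le_one [IsProbabilityMeasure ν] : ‖expChar ν A‖ ≤ 1 := by
  refine (norm_integral_le_integral_norm _).trans ?_
  simp [norm_exp_ofReal_mul_I]

theorem expChar_neg : expChar ν (fun ω => -A ω) = (starRingEnd ℂ) (expChar ν A) := by
  rw [expChar, expChar, ← integral_conj]
  congr with ω
  rw [← exp_conj]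
  simp

theorem continuous_expChar_mul [IsFiniteMeasure ν] (hA : Measurable A) :
    Continuous fun τ : ℝ => expChar ν fun ω => τ * A ω := by
  refine continuous_of_dominated (F := fun (τ : ℝ) ω => cexp ((τ * A ω : ℝ) * I))
    (bound := fun _ => 1) (fun τ => by fun_prop) (fun τ => ?_) (integrable_const _) ?_
  · exact Eventually.of_forall fun ω => (norm_exp_ofReal_mul_I _).le
  · exact Eventually.of_forall fun ω => by fun_prop

theorem norm_expChar_mul_sub_le [IsFiniteMeasure ν] (hA : Measurable A) (σ τ : ℝ) :
    ‖expChar ν (fun ω => σ * A ω) - expChar ν fun ω => τ * A ω‖ ≤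
      ∫ ω, ‖cexp (((τ - σ) * A ω : ℝ) * I) - 1‖ ∂ν := by
  have h (ρ : ℝ) : Measurable fun ω => ρ * A ω := hA.const_mul ρ
  rw [expChar, expChar, ← integral_sub (integrable_cexp_mul_I (h σ)) (integrable_cexp_mul_I (h τ))]
  refine (norm_integral_le_integral_norm _).trans (le_of_eq ?_)
  congr with ω
  have : cexp ((τ * A ω : ℝ) * I) =
      cexp ((σ * A ω : ℝ) * I) * cexp (((τ - σ) * A ω : ℝ) * I) := by
    rw [← Complex.exp_add]
    congr 1
    push_cast
    ring
  rw [this, norm_sub_rev, ← mul_sub_one, norm_mul, norm_exp_ofReal_mul_I, one_mul]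

theorem norm_cexp_sub_one_le_two (x : ℝ) : ‖cexp (x * I) - 1‖ ≤ 2 := by
  refine (norm_sub_le _ _).trans ?_
  rw [norm_exp_ofReal_mul_I, norm_one]
  norm_num

theorem integrable_norm_cexp_sub_one [IsFiniteMeasure ν] (hA : Measurable A) :
    Integrable (fun ω => ‖cexp (A ω * I) - 1‖) ν :=
  ((integrable_cexp_mul_I hA).sub (integrable_const 1)).norm

theorem continuous_integral_norm_cexp_sub_one [IsFiniteMeasure ν] (hA : Measurable A) :
    Continuous fun h : ℝ => ∫ ω, ‖cexp ((h * A ω : ℝ) * I) - 1‖ ∂ν := by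
  refine continuous_of_dominated (bound := fun _ => 2) (fun τ => by fun_prop) (fun τ => ?_)
    (integrable_const _) ?_
  · exact Eventually.of_forall fun ω => by
      rw [norm_norm]; exact norm_cexp_sub_one_le_two _
  · exact Eventually.of_forall fun ω => by fun_prop

theorem integral_norm_cexp_add_sub_one_le [IsFiniteMeasure ν] (hA : Measurable A)
    (hB : Measurable B) :
    ∫ ω, ‖cexp ((A ω + B ω : ℝ) * I) - 1‖ ∂ν ≤
      ∫ ω, ‖cexp (A ω * I) - 1‖ ∂ν + ∫ ω, ‖cexp (B ω * I) - 1‖ ∂ν := by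
  rw [← integral_add (integrable_norm_cexp_sub_one hA) (integrable_norm_cexp_sub_one hB)]
  refine integral_mono (integrable_norm_cexp_sub_one (hA.add hB))
    ((integrable_norm_cexp_sub_one hA).add (integrable_norm_cexp_sub_one hB)) fun ω => ?_
  have : cexp ((A ω + B ω : ℝ) * I) - 1 =
      (cexp (A ω * I) - 1) + cexp (A ω * I) * (cexp (B ω * I) - 1) := by
    push_cast
    rw [add_mul, Complex.exp_add]
    ring
  dsimp only
  rw [this]
  refine (norm_add_le _ _).trans (le_of_eq ?_)
  rw [norm_mul, norm_exp_ofReal_mul_I, one_mul]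

/-- Doubling inequality for the modulus of a characteristic function. -/
theorem one_sub_norm_expChar_two_mul_le [IsProbabilityMeasure ν] (hA : Measurable A) :
    1 - ‖expChar ν (fun ω => 2 * A ω)‖ ≤ 4 * (1 - ‖expChar ν A‖) := by
  obtain ⟨c, hc, hcA⟩ : ∃ c : ℂ, ‖c‖ = 1 ∧ expChar ν A * c = ‖expChar ν A‖ := by
    obtain h | h := eq_or_ne (expChar ν A) 0
    · exact ⟨1, by simp, by simp [h]⟩
    · refine ⟨‖expChar ν A‖ / expChar ν A, ?_, mul_div_cancel₀ _ h⟩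
      rw [norm_div, norm_real, norm_norm, div_self (norm_ne_zero_iff.2 h)]
  have hpt (ω : Ω) : 1 - (cexp ((2 * A ω : ℝ) * I) * c ^ 2).re ≤
      4 * (1 - (cexp (A ω * I) * c).re) := by
    set z := cexp (A ω * I) * c with hz
    have hz1 : ‖z‖ = 1 := by rw [hz, norm_mul, norm_exp_ofReal_mul_I, hc, one_mul]
    have hz2 : cexp ((2 * A ω : ℝ) * I) * c ^ 2 = z ^ 2 := by
      rw [hz, mul_pow, ← exp_nat_mul]
      congr 2
      push_cast
      ring
    have hsq : z.re ^ 2 + z.im ^ 2 = 1 := by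
      have := Complex.sq_norm z
      rw [hz1, normSq_apply] at this
      nlinarith
    rw [hz2, sq z, mul_re]
    nlinarith [sq_nonneg (z.re - 1)]
  have h2A : Measurable fun ω => 2 * A ω := hA.const_mul 2
  have i1 : Integrable (fun ω => cexp ((2 * A ω : ℝ) * I) * c ^ 2) ν :=
    (integrable_cexp_mul_I h2A).mul_const _
  have i2 : Integrable (fun ω => cexp (A ω * I) * c) ν := (integrable_cexp_mul_I hA).mul_const _
  have hmono := integral_mono ((integrable_const (1 : ℝ)).sub i1.re)
    (((integrable_const (1 : ℝ)).sub i2.re).const_mul 4) hpt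
  simp only [Pi.sub_apply] at hmono
  rw [integral_const_mul, integral_sub (integrable_const _) i1.re,
    integral_sub (integrable_const _) i2.re, integral_re i1, integral_re i2,
    integral_mul_const, integral_mul_const] at hmono
  change _ - (expChar ν (fun ω => 2 * A ω) * c ^ 2).re ≤ 4 * (_ - (expChar ν A * c).re) at hmono
  rw [hcA] at hmono
  have := re_le_norm (expChar ν (fun ω => 2 * A ω) * c ^ 2)
  rw [norm_mul, norm_pow, hc, one_pow, mul_one] at this
  simp only [integral_const, probReal_univ, one_smul, ofReal_re] at hmono
  linarith

end expChar

/-- The characteristic function of a random variable all of whose convolution roots exist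
does not vanish. -/
theorem expChar_ne_zero_of_roots {E : Type*} [MeasurableSpace E] {μ : Measure E}
    [IsProbabilityMeasure μ] {A : E → ℝ} (hA : Measurable A)
    (hroots : ∀ n : ℕ, 1 ≤ n → ∃ ρ : Measure E, IsProbabilityMeasure ρ ∧
      ∀ τ : ℝ, (expChar ρ fun x => τ * A x) ^ n = expChar μ fun x => τ * A x) (τ : ℝ) :
    (expChar μ fun x => τ * A x) ≠ 0 := by
  have hdouble (σ : ℝ) (hσ : (expChar μ fun x => σ * A x) ≠ 0) :
      (expChar μ fun x => (2 * σ) * A x) ≠ 0 := by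
    obtain ⟨n, hn⟩ := exists_pow_lt_of_lt_one (norm_pos_iff.2 hσ) (by norm_num : (3 / 4 : ℝ) < 1)
    obtain ⟨ρ, hρ, hρn⟩ := hroots (n + 1) (by omega)
    have hbig : 3 / 4 < ‖expChar ρ fun x => σ * A x‖ := by
      by_contra! hle
      have h1 : ‖expChar ρ fun x => σ * A x‖ ^ (n + 1) ≤ (3 / 4) ^ (n + 1) :=
        pow_le_pow_left₀ (norm_nonneg _) hle _
      rw [← norm_pow, hρn, pow_succ] at h1
      have : (0 : ℝ) < (3 / 4) ^ n := by positivity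
      linarith
    have hd := one_sub_norm_expChar_two_mul_le (ν := ρ) (hA.const_mul σ)
    intro h0
    rw [← hρn] at h0
    have h0' := eq_zero_of_pow_eq_zero h0
    simp only [← mul_assoc, h0', norm_zero] at hd
    linarith
  have hsmall : ∃ N : ℕ, (expChar μ fun x => τ * (1 / 2) ^ N * A x) ≠ 0 := by
    have h1 : Tendsto (fun N : ℕ => τ * (1 / 2 : ℝ) ^ N) atTop (𝓝 0) := by
      simpa using (tendsto_pow_atTop_nhds_zero_of_lt_one (r := (1 / 2 : ℝ)) (by norm_num)
        (by norm_num)).const_mul τ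
    have h2 := ((continuous_expChar_mul (ν := μ) hA).tendsto 0).comp h1
    refine (h2.eventually_ne ?_).exists
    simp [expChar]
  obtain ⟨N, hN⟩ := hsmall
  induction N with
  | zero => simpa using hN
  | succ N ih =>
    refine ih ?_
    have h := hdouble _ hN
    rwa [show 2 * (τ * (1 / 2) ^ (N + 1)) = τ * (1 / 2 : ℝ) ^ N by ring] at h

/-- Convolution roots of a fixed infinitely divisible law have characteristic functions
`1 + O(1 / n)`. -/
theorem exists_bound_expChar_root_sub_one {E : Type*} [MeasurableSpace E] {μ : Measure E}
    [IsProbabilityMeasure μ] {A : E → ℝ} (hA : Measurable A)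
    (hne : ∀ τ : ℝ, (expChar μ fun x => τ * A x) ≠ 0) :
    ∃ K : ℝ, 0 ≤ K ∧ ∀ n : ℕ, 1 ≤ n → ∀ {F : Type*} [MeasurableSpace F] (ρ : Measure F)
      [IsProbabilityMeasure ρ] (B : F → ℝ), Measurable B →
      (∀ τ : ℝ, (expChar ρ fun x => τ * B x) ^ n = expChar μ fun x => τ * A x) →
      ‖expChar ρ B - 1‖ ≤ K / n := by
  have hsc : IsSimplyConnected (univ : Set ℝ) := by
    have : ContractibleSpace (univ : Set ℝ) := convex_univ.contractibleSpace univ_nonempty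
    exact SimplyConnectedSpace.ofContractible _
  obtain ⟨f, hfc, hf⟩ := exists_continuousOn_eqOn_exp_comp hsc isOpen_univ
    (g := fun τ : ℝ => expChar μ fun x => τ * A x) (continuous_expChar_mul hA).continuousOn
    (by rintro ⟨τ, -, h⟩; exact hne τ h)
  have hf' (τ : ℝ) : cexp (f τ) = expChar μ fun x => τ * A x := hf (mem_univ τ)
  have hf0 : cexp (f 0) = 1 := by simp [hf', expChar]
  refine ⟨2 * ‖f 1 - f 0‖, by positivity, fun n hn F _ ρ _ B hB hroot => ?_⟩
  have hn0 : (n : ℂ) ≠ 0 := Nat.cast_ne_zero.2 (by omega)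
  have hnpos : (0 : ℝ) < n := Nat.cast_pos.2 hn
  have key : (expChar ρ fun x => (1 : ℝ) * B x) = cexp ((f 1 - f 0) / n) := by
    refine isPreconnected_univ.eqOn_of_pow_eq (n := n) (by omega)
      (f := fun τ : ℝ => expChar ρ fun x => τ * B x) (g := fun τ => cexp ((f τ - f 0) / n))
      (continuous_expChar_mul hB).continuousOn (((hfc.sub continuousOn_const).div_const _).cexp)
      (fun τ _ => ?_) (fun _ _ => exp_ne_zero _) (mem_univ 0) ?_ (mem_univ 1)
    · rw [hroot, ← exp_nat_mul, mul_div_cancel₀ _ hn0, exp_sub, hf0, div_one, hf']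
    · simp [expChar]
  simp only [one_mul] at key
  rw [le_div_iff₀ hnpos]
  obtain h | h := le_total ‖f 1 - f 0‖ n
  · have h1 : ‖(f 1 - f 0) / n‖ ≤ 1 := by
      rw [norm_div, norm_natCast]
      exact (div_le_one hnpos).2 h
    have h2 := norm_exp_sub_one_le h1
    rw [← key, norm_div, norm_natCast, ← mul_div_assoc, le_div_iff₀ hnpos] at h2
    exact h2
  · have h1 : ‖expChar ρ B - 1‖ ≤ 2 := by
      refine (norm_sub_le _ _).trans ?_
      have := norm_expChar_le_one (ν := ρ) (A := B)
      rw [norm_one]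
      linarith
    nlinarith [norm_nonneg (f 1 - f 0)]

/-- A bounded sequence in a Hilbert space which is asymptotically orthogonal to each of its
members converges weakly to `0`. -/
theorem tendsto_inner_zero_of_asymptotically_orthogonal {H : Type*} [NormedAddCommGroup H]
    [InnerProductSpace ℂ H] [CompleteSpace H] {v : ℕ → H} {C : ℝ} (hC : ∀ n, ‖v n‖ ≤ C)
    (horth : ∀ m, Tendsto (fun n => inner ℂ (v m) (v n)) atTop (𝓝 0)) (z : H) :
    Tendsto (fun n => inner ℂ z (v n)) atTop (𝓝 0) := by
  set K := (Submodule.span ℂ (range v)).topologicalClosure with hK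
  have hmem (n : ℕ) : v n ∈ K :=
    Submodule.le_topologicalClosure _ (Submodule.subset_span (mem_range_self n))
  have hspan : ∀ y ∈ Submodule.span ℂ (range v),
      Tendsto (fun n => inner ℂ y (v n)) atTop (𝓝 0) := by
    intro y hy
    induction hy using Submodule.span_induction with
    | mem x hx =>
      obtain ⟨m, rfl⟩ := hx
      exact horth m
    | zero => simp
    | add x y _ _ hx hy => simpa [inner_add_left] using hx.add hy
    | smul a x _ hx =>
      simpa [inner_smul_left, mul_comm] using hx.const_mul ((starRingEnd ℂ) a)
  have hclos : ∀ y ∈ K, Tendsto (fun n => inner ℂ y (v n)) atTop (𝓝 0) := by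
    intro y hy
    rw [Metric.tendsto_nhds]
    intro ε hε
    have hC0 : 0 ≤ C := (norm_nonneg _).trans (hC 0)
    obtain ⟨x, hx, hxy⟩ := Metric.mem_closure_iff.1 hy (ε / (2 * (C + 1))) (by positivity)
    filter_upwards [Metric.tendsto_nhds.1 (hspan x hx) (ε / 2) (by positivity)] with n hn
    rw [dist_zero_right] at hn ⊢
    have h1 : inner ℂ y (v n) = inner ℂ (y - x) (v n) + inner ℂ x (v n) := by
      rw [← inner_add_left, sub_add_cancel]
    have h2 : ‖inner ℂ (y - x) (v n)‖ ≤ ε / (2 * (C + 1)) * (C + 1) := by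
      refine (norm_inner_le_norm _ _).trans ?_
      rw [dist_eq_norm] at hxy
      exact mul_le_mul hxy.le ((hC n).trans (by linarith)) (norm_nonneg _) (by positivity)
    have h3 : ε / (2 * (C + 1)) * (C + 1) = ε / 2 := by field_simp
    rw [h1]
    exact (norm_add_le _ _).trans_lt (by linarith)
  have : K.HasOrthogonalProjection := by
    have : CompleteSpace K := (Submodule.isClosed_topologicalClosure _).completeSpace_coe
    infer_instance
  refine (hclos _ (K.starProjection_apply_mem z)).congr fun n => ?_
  rw [K.inner_starProjection_left_eq_right, K.starProjection_eq_self_iff.2 (hmem n)]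

theorem norm_prod_one_add_sub_one_le {ι : Type*} (s : Finset ι) {u : ι → ℂ}
    (hu : ∀ i, ‖1 + u i‖ = 1) :
    ‖∏ i ∈ s, (1 + u i) - 1‖ ≤ ∑ i ∈ s, ‖u i‖ ∧
      ‖∏ i ∈ s, (1 + u i) - 1 - ∑ i ∈ s, u i‖ ≤ (∑ i ∈ s, ‖u i‖) ^ 2 := by
  classical
  induction s using Finset.induction_on with
  | empty => simp
  | insert a s ha ih =>
    obtain ⟨ih1, ih2⟩ := ih
    have hs : 0 ≤ ∑ i ∈ s, ‖u i‖ := Finset.sum_nonneg fun _ _ => norm_nonneg _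
    rw [Finset.prod_insert ha, Finset.sum_insert ha, Finset.sum_insert ha]
    set p := ∏ i ∈ s, (1 + u i) with hp
    have hpn : ‖p‖ = 1 := by simp [hp, norm_prod, hu]
    constructor
    · have h : (1 + u a) * p - 1 = u a * p + (p - 1) := by ring
      rw [h]
      refine (norm_add_le _ _).trans ?_
      rw [norm_mul, hpn, mul_one]
      linarith
    · have h : (1 + u a) * p - 1 - (u a + ∑ i ∈ s, u i) =
          u a * (p - 1) + (p - 1 - ∑ i ∈ s, u i) := by ring
      rw [h]
      refine (norm_add_le _ _).trans ?_
      rw [norm_mul]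
      nlinarith [norm_nonneg (u a), mul_le_mul_of_nonneg_left ih1 (norm_nonneg (u a))]

theorem sq_sum_mul_sum_le {m : ℕ} {x y : Fin m → ℝ} (hy : ∀ j, 0 ≤ y j) :
    (∑ i, x i) ^ 2 * ∑ j, y j ≤ m * ∑ i, ∑ j, x i ^ 2 * y j := by
  have h := sq_sum_le_card_mul_sum_sq (s := Finset.univ) (f := x)
  rw [Finset.card_univ, Fintype.card_fin] at h
  refine (mul_le_mul_of_nonneg_right h (Finset.sum_nonneg fun j _ => hy j)).trans (le_of_eq ?_)
  rw [mul_assoc, Finset.sum_mul_sum]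

theorem sq_mul_le_add {x y η : ℝ} (hη : 0 < η) :
    x ^ 2 * y ≤ η * x ^ 2 + x ^ 2 * y ^ 2 / η := by
  have h : y ≤ η + y ^ 2 / η := by
    rw [← sub_nonneg]
    have : η + y ^ 2 / η - y = ((η - y) ^ 2 + η ^ 2 + y ^ 2) / (2 * η) := by
      field_simp
      ring
    rw [this]
    positivity
  calc x ^ 2 * y ≤ x ^ 2 * (η + y ^ 2 / η) := mul_le_mul_of_nonneg_left h (sq_nonneg x)
    _ = _ := by ring

/-- Pointwise second order expansion of a product of two characters of sums. -/
theorem norm_prod_sub_sum_mul_sum_le {m : ℕ} {u w : Fin m → ℂ} (hu : ∀ i, ‖1 + u i‖ = 1)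
    (hw : ∀ j, ‖1 + w j‖ = 1) {η : ℝ} (hη : 0 < η) :
    ‖(∏ i, (1 + u i) - 1) * (∏ j, (1 + w j) - 1) - ∑ i, ∑ j, u i * w j‖ ≤
      m * ∑ i, ∑ j, (η * (‖u i‖ ^ 2 + ‖w j‖ ^ 2) + 2 * (‖u i‖ ^ 2 * ‖w j‖ ^ 2) / η) := by
  obtain ⟨-, hU2⟩ := norm_prod_one_add_sub_one_le Finset.univ hu
  obtain ⟨hW1, hW2⟩ := norm_prod_one_add_sub_one_le Finset.univ hw
  set U := ∏ i, (1 + u i) - 1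
  set W := ∏ j, (1 + w j) - 1
  have hdec : U * W - ∑ i, ∑ j, u i * w j =
      (U - ∑ i, u i) * W + (∑ i, u i) * (W - ∑ j, w j) := by
    rw [← Finset.sum_mul_sum]
    ring
  have h1 : ‖(U - ∑ i, u i) * W‖ ≤ (∑ i, ‖u i‖) ^ 2 * ∑ j, ‖w j‖ := by
    rw [norm_mul]
    exact mul_le_mul hU2 hW1 (norm_nonneg _) (sq_nonneg _)
  have h2 : ‖(∑ i, u i) * (W - ∑ j, w j)‖ ≤ (∑ j, ‖w j‖) ^ 2 * ∑ i, ‖u i‖ := by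
    rw [norm_mul, mul_comm]
    exact mul_le_mul hW2 (norm_sum_le _ _) (norm_nonneg _) (sq_nonneg _)
  have h3 := sq_sum_mul_sum_le (x := fun i => ‖u i‖) fun j => norm_nonneg (w j)
  have h4 := sq_sum_mul_sum_le (x := fun j => ‖w j‖) fun i => norm_nonneg (u i)
  rw [hdec]
  refine (norm_add_le _ _).trans ((add_le_add (h1.trans h3) (h2.trans h4)).trans ?_)
  rw [Finset.sum_comm (f := fun j i => ‖w j‖ ^ 2 * ‖u i‖), ← mul_add, ← Finset.sum_add_distrib]
  refine mul_le_mul_of_nonneg_left ?_ (Nat.cast_nonneg m)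
  refine Finset.sum_le_sum fun i _ => ?_
  rw [← Finset.sum_add_distrib]
  refine Finset.sum_le_sum fun j _ => ?_
  have h5 := sq_mul_le_add (x := ‖u i‖) (y := ‖w j‖) hη
  have h6 := sq_mul_le_add (x := ‖w j‖) (y := ‖u i‖) hη
  rw [mul_comm (‖w j‖ ^ 2) (‖u i‖ ^ 2)] at h6
  calc _ ≤ _ := add_le_add h5 h6
    _ = _ := by ring

theorem sq_norm_cexp_sub_one (x : ℝ) :
    ((‖cexp (x * I) - 1‖ ^ 2 : ℝ) : ℂ) =
      -((cexp (x * I) - 1) + (cexp ((-x : ℝ) * I) - 1)) := by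
  have hconj : (starRingEnd ℂ) (cexp (x * I)) = cexp ((-x : ℝ) * I) := by
    rw [← exp_conj]
    simp
  have hmul : cexp (x * I) * cexp ((-x : ℝ) * I) = 1 := by
    rw [← Complex.exp_add]
    simp
  rw [ofReal_pow, ← mul_conj', map_sub, hconj, map_one]
  linear_combination hmul

section estimate

variable {Ω : Type*} [MeasurableSpace Ω] {ν : Measure Ω}

/-- The covariance of the characters of `A` and `B`. -/
def charCov {Ω : Type*} [MeasurableSpace Ω] (ν : Measure Ω) (A B : Ω → ℝ) : ℂ :=
  expChar ν (fun ω => A ω + B ω) - expChar ν A * expChar ν B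

theorem norm_expChar_neg_sub_one {A : Ω → ℝ} :
    ‖expChar ν (fun ω => -A ω) - 1‖ = ‖expChar ν A - 1‖ := by
  rw [expChar_neg, ← norm_conj (expChar ν A - 1), map_sub, map_one]

theorem norm_charCov_neg_neg {A B : Ω → ℝ} :
    ‖charCov ν (fun ω => -A ω) fun ω => -B ω‖ = ‖charCov ν A B‖ := by
  rw [← norm_conj (charCov ν A B), charCov, charCov, map_sub, map_mul, ← expChar_neg,
    ← expChar_neg, ← expChar_neg]
  simp only [neg_add]

variable [IsProbabilityMeasure ν]

theorem integral_cexp_sub_one_mul {A B : Ω → ℝ} (hA : Measurable A) (hB : Measurable B) :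
    ∫ ω, (cexp (A ω * I) - 1) * (cexp (B ω * I) - 1) ∂ν =
      charCov ν A B + (expChar ν A - 1) * (expChar ν B - 1) := by
  have h (ω : Ω) : (cexp (A ω * I) - 1) * (cexp (B ω * I) - 1) =
      cexp ((A ω + B ω : ℝ) * I) - cexp (A ω * I) - cexp (B ω * I) + 1 := by
    push_cast
    rw [add_mul, Complex.exp_add]
    ring
  have iA := integrable_cexp_mul_I (ν := ν) hA
  have iB := integrable_cexp_mul_I (ν := ν) hB
  have iAB := integrable_cexp_mul_I (ν := ν) (hA.add hB)
  simp only [Pi.add_apply] at iAB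
  have i1 : Integrable (fun ω => cexp ((A ω + B ω : ℝ) * I) - cexp (A ω * I)) ν := iAB.sub iA
  have i2 : Integrable (fun ω => cexp ((A ω + B ω : ℝ) * I) - cexp (A ω * I) - cexp (B ω * I)) ν :=
    i1.sub iB
  simp_rw [h]
  rw [integral_add i2 (integrable_const _), integral_sub i1 iB, integral_sub iAB iA]
  simp only [charCov, expChar, integral_const, probReal_univ, one_smul]
  ring

theorem norm_integral_cexp_sub_one_mul_le {A B : Ω → ℝ} (hA : Measurable A) (hB : Measurable B)
    {δ D : ℝ} (hδA : ‖expChar ν A - 1‖ ≤ δ) (hδB : ‖expChar ν B - 1‖ ≤ δ)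
    (hD : ‖charCov ν A B‖ ≤ D) :
    ‖∫ ω, (cexp (A ω * I) - 1) * (cexp (B ω * I) - 1) ∂ν‖ ≤ D + δ ^ 2 := by
  rw [integral_cexp_sub_one_mul hA hB]
  refine (norm_add_le _ _).trans (add_le_add hD ?_)
  rw [norm_mul, sq]
  exact mul_le_mul hδA hδB (norm_nonneg _) ((norm_nonneg _).trans hδA)

theorem integrable_cexp_sub_one_mul {A B : Ω → ℝ} (hA : Measurable A) (hB : Measurable B) :
    Integrable (fun ω => (cexp (A ω * I) - 1) * (cexp (B ω * I) - 1)) ν := by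
  refine (integrable_const (4 : ℝ)).mono (by fun_prop) (Eventually.of_forall fun ω => ?_)
  rw [norm_mul]
  have h1 := norm_cexp_sub_one_le_two (A ω)
  have h2 := norm_cexp_sub_one_le_two (B ω)
  norm_num
  nlinarith [norm_nonneg (cexp (A ω * I) - 1), norm_nonneg (cexp (B ω * I) - 1)]

theorem integrable_sq_norm_cexp_sub_one {A : Ω → ℝ} (hA : Measurable A) :
    Integrable (fun ω => ‖cexp (A ω * I) - 1‖ ^ 2) ν := by
  refine (integrable_cexp_sub_one_mul (ν := ν) hA hA).norm.congr (Eventually.of_forall fun ω => ?_)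
  simp only [norm_mul, sq]

theorem integrable_sq_norm_mul_sq_norm {A B : Ω → ℝ} (hA : Measurable A) (hB : Measurable B) :
    Integrable (fun ω => ‖cexp (A ω * I) - 1‖ ^ 2 * ‖cexp (B ω * I) - 1‖ ^ 2) ν := by
  refine (integrable_const (16 : ℝ)).mono (by fun_prop) (Eventually.of_forall fun ω => ?_)
  have h1 := pow_le_pow_left₀ (norm_nonneg _) (norm_cexp_sub_one_le_two (A ω)) 2
  have h2 := pow_le_pow_left₀ (norm_nonneg _) (norm_cexp_sub_one_le_two (B ω)) 2
  rw [Real.norm_of_nonneg (by positivity)]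
  calc _ ≤ (2 : ℝ) ^ 2 * 2 ^ 2 := mul_le_mul h1 h2 (by positivity) (by positivity)
    _ = ‖(16 : ℝ)‖ := by norm_num

theorem integral_sq_norm_cexp_sub_one_le {A : Ω → ℝ} (hA : Measurable A) {δ : ℝ}
    (hδ : ‖expChar ν A - 1‖ ≤ δ) : ∫ ω, ‖cexp (A ω * I) - 1‖ ^ 2 ∂ν ≤ 2 * δ := by
  have hA' : Measurable fun ω => -A ω := hA.neg
  have i1 : Integrable (fun ω => cexp (A ω * I) - 1) ν :=
    (integrable_cexp_mul_I hA).sub (integrable_const 1)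
  have i2 : Integrable (fun ω => cexp ((-A ω : ℝ) * I) - 1) ν :=
    (integrable_cexp_mul_I hA').sub (integrable_const 1)
  have h : ((∫ ω, ‖cexp (A ω * I) - 1‖ ^ 2 ∂ν : ℝ) : ℂ) =
      -((expChar ν A - 1) + (expChar ν (fun ω => -A ω) - 1)) := by
    rw [← integral_complex_ofReal]
    simp_rw [sq_norm_cexp_sub_one]
    rw [integral_neg, integral_add i1 i2,
      integral_sub (integrable_cexp_mul_I hA) (integrable_const _),
      integral_sub (integrable_cexp_mul_I hA') (integrable_const _)]
    simp [expChar]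
  have h' := congrArg norm h
  rw [norm_real, norm_neg] at h'
  refine (Real.le_norm_self _).trans (h'.le.trans ((norm_add_le _ _).trans ?_))
  rw [norm_expChar_neg_sub_one]
  linarith

theorem integral_sq_norm_mul_sq_norm_le {A B : Ω → ℝ} (hA : Measurable A) (hB : Measurable B)
    {δ D : ℝ} (hδA : ‖expChar ν A - 1‖ ≤ δ) (hδB : ‖expChar ν B - 1‖ ≤ δ)
    (hD : ‖charCov ν A B‖ ≤ D) (hD' : ‖charCov ν A fun ω => -B ω‖ ≤ D) :
    ∫ ω, ‖cexp (A ω * I) - 1‖ ^ 2 * ‖cexp (B ω * I) - 1‖ ^ 2 ∂ν ≤ 4 * (D + δ ^ 2) := by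
  have hA' : Measurable fun ω => -A ω := hA.neg
  have hB' : Measurable fun ω => -B ω := hB.neg
  have hδA' := (norm_expChar_neg_sub_one (ν := ν) (A := A)).trans_le hδA
  have hδB' := (norm_expChar_neg_sub_one (ν := ν) (A := B)).trans_le hδB
  have hDn := (norm_charCov_neg_neg (ν := ν) (A := A) (B := B)).trans_le hD
  have hDn' := (norm_charCov_neg_neg (ν := ν) (A := A) (B := fun ω => -B ω)).trans_le hD'
  simp only [neg_neg] at hDn'
  have b1 := norm_integral_cexp_sub_one_mul_le hA hB hδA hδB hD
  have b2 := norm_integral_cexp_sub_one_mul_le hA hB' hδA hδB' hD'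
  have b3 := norm_integral_cexp_sub_one_mul_le hA' hB hδA' hδB hDn'
  have b4 := norm_integral_cexp_sub_one_mul_le hA' hB' hδA' hδB' hDn
  have i1 := integrable_cexp_sub_one_mul (ν := ν) hA hB
  have i2 := integrable_cexp_sub_one_mul (ν := ν) hA hB'
  have i3 := integrable_cexp_sub_one_mul (ν := ν) hA' hB
  have i4 := integrable_cexp_sub_one_mul (ν := ν) hA' hB'
  have h : ((∫ ω, ‖cexp (A ω * I) - 1‖ ^ 2 * ‖cexp (B ω * I) - 1‖ ^ 2 ∂ν : ℝ) : ℂ) =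
      (∫ ω, (cexp (A ω * I) - 1) * (cexp (B ω * I) - 1) ∂ν +
        ∫ ω, (cexp (A ω * I) - 1) * (cexp ((-B ω : ℝ) * I) - 1) ∂ν) +
      (∫ ω, (cexp ((-A ω : ℝ) * I) - 1) * (cexp (B ω * I) - 1) ∂ν +
        ∫ ω, (cexp ((-A ω : ℝ) * I) - 1) * (cexp ((-B ω : ℝ) * I) - 1) ∂ν) := by
    have i12 : Integrable (fun ω => (cexp (A ω * I) - 1) * (cexp (B ω * I) - 1) +
        (cexp (A ω * I) - 1) * (cexp ((-B ω : ℝ) * I) - 1)) ν := i1.add i2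
    have i34 : Integrable (fun ω => (cexp ((-A ω : ℝ) * I) - 1) * (cexp (B ω * I) - 1) +
        (cexp ((-A ω : ℝ) * I) - 1) * (cexp ((-B ω : ℝ) * I) - 1)) ν := i3.add i4
    rw [← integral_add i1 i2, ← integral_add i3 i4, ← integral_add i12 i34,
      ← integral_complex_ofReal]
    congr with ω
    rw [ofReal_mul, sq_norm_cexp_sub_one, sq_norm_cexp_sub_one]
    ring
  have h' := congrArg norm h
  rw [norm_real] at h'
  refine (Real.le_norm_self _).trans (h'.le.trans ?_)
  refine (norm_add_le _ _).trans ?_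
  have := norm_add_le (∫ ω, (cexp (A ω * I) - 1) * (cexp (B ω * I) - 1) ∂ν)
    (∫ ω, (cexp (A ω * I) - 1) * (cexp ((-B ω : ℝ) * I) - 1) ∂ν)
  have := norm_add_le (∫ ω, (cexp ((-A ω : ℝ) * I) - 1) * (cexp (B ω * I) - 1) ∂ν)
    (∫ ω, (cexp ((-A ω : ℝ) * I) - 1) * (cexp ((-B ω : ℝ) * I) - 1) ∂ν)
  linarith

/-- Pairwise almost decorrelated families of real random variables whose characters are close to
`1` have almost decorrelated sums, up to second order terms. -/
theorem norm_charCov_sum_le {m : ℕ} {A B : Fin m → Ω → ℝ} (hA : ∀ i, Measurable (A i))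
    (hB : ∀ j, Measurable (B j)) {δ D η : ℝ} (hη : 0 < η)
    (hδA : ∀ i, ‖expChar ν (A i) - 1‖ ≤ δ) (hδB : ∀ j, ‖expChar ν (B j) - 1‖ ≤ δ)
    (hδA' : ‖expChar ν (fun ω => ∑ i, A i ω) - 1‖ ≤ δ)
    (hδB' : ‖expChar ν (fun ω => ∑ j, B j ω) - 1‖ ≤ δ)
    (hD : ∀ i j, ‖charCov ν (A i) (B j)‖ ≤ D)
    (hD' : ∀ i j, ‖charCov ν (A i) fun ω => -B j ω‖ ≤ D) :
    ‖charCov ν (fun ω => ∑ i, A i ω) fun ω => ∑ j, B j ω‖ ≤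
      (m ^ 2 : ℝ) * (D + δ ^ 2) + m ^ 3 * (η * (4 * δ) + 8 * (D + δ ^ 2) / η) + δ ^ 2 := by
  have hSA : Measurable fun ω => ∑ i, A i ω := Finset.measurable_fun_sum _ fun i _ => hA i
  have hSB : Measurable fun ω => ∑ j, B j ω := Finset.measurable_fun_sum _ fun j _ => hB j
  have hδ : 0 ≤ δ := (norm_nonneg _).trans hδA'
  set u : Fin m → Ω → ℂ := fun i ω => cexp (A i ω * I) - 1 with hu
  set w : Fin m → Ω → ℂ := fun j ω => cexp (B j ω * I) - 1 with hw
  have hu1 (ω : Ω) (i : Fin m) : ‖1 + u i ω‖ = 1 := by simp [hu, norm_exp_ofReal_mul_I]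
  have hw1 (ω : Ω) (j : Fin m) : ‖1 + w j ω‖ = 1 := by simp [hw, norm_exp_ofReal_mul_I]
  have hprodu (ω : Ω) : cexp ((∑ i, A i ω : ℝ) * I) = ∏ i, (1 + u i ω) := by
    simp [hu, Finset.sum_mul, Complex.exp_sum]
  have hprodw (ω : Ω) : cexp ((∑ j, B j ω : ℝ) * I) = ∏ j, (1 + w j ω) := by
    simp [hw, Finset.sum_mul, Complex.exp_sum]
  set R : Ω → ℝ := fun ω => m * ∑ i, ∑ j, (η * (‖u i ω‖ ^ 2 + ‖w j ω‖ ^ 2) +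
    2 * (‖u i ω‖ ^ 2 * ‖w j ω‖ ^ 2) / η) with hR
  have iuw (i j : Fin m) : Integrable (fun ω => u i ω * w j ω) ν :=
    integrable_cexp_sub_one_mul (hA i) (hB j)
  have isum : Integrable (fun ω => ∑ i, ∑ j, u i ω * w j ω) ν :=
    integrable_finsetSum _ fun i _ => integrable_finsetSum _ fun j _ => iuw i j
  have iterm (i j : Fin m) : Integrable (fun ω => η * (‖u i ω‖ ^ 2 + ‖w j ω‖ ^ 2) +
      2 * (‖u i ω‖ ^ 2 * ‖w j ω‖ ^ 2) / η) ν :=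
    (((integrable_sq_norm_cexp_sub_one (hA i)).add
      (integrable_sq_norm_cexp_sub_one (hB j))).const_mul η).add
      (((integrable_sq_norm_mul_sq_norm (hA i) (hB j)).const_mul 2).div_const η)
  have iR : Integrable R ν :=
    (integrable_finsetSum _ fun i _ => integrable_finsetSum _ fun j _ => iterm i j).const_mul _
  have hmain := integral_cexp_sub_one_mul (ν := ν) hSA hSB
  have iUW := integrable_cexp_sub_one_mul (ν := ν) hSA hSB
  set UW : Ω → ℂ :=
    fun ω => (cexp ((∑ i, A i ω : ℝ) * I) - 1) * (cexp ((∑ j, B j ω : ℝ) * I) - 1) with hUW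
  have hrem : ‖∫ ω, UW ω ∂ν - ∫ ω, ∑ i, ∑ j, u i ω * w j ω ∂ν‖ ≤ ∫ ω, R ω ∂ν := by
    rw [← integral_sub iUW isum]
    refine norm_integral_le_of_norm_le iR (Eventually.of_forall fun ω => ?_)
    simp only [hUW, hprodu, hprodw, hR]
    exact norm_prod_sub_sum_mul_sum_le (hu1 ω) (hw1 ω) hη
  have hRle : ∫ ω, R ω ∂ν ≤ m ^ 3 * (η * (4 * δ) + 8 * (D + δ ^ 2) / η) := by
    have hterm (i j : Fin m) : ∫ ω, (η * (‖u i ω‖ ^ 2 + ‖w j ω‖ ^ 2) +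
        2 * (‖u i ω‖ ^ 2 * ‖w j ω‖ ^ 2) / η) ∂ν ≤ η * (4 * δ) + 8 * (D + δ ^ 2) / η := by
      have j1 : Integrable (fun ω => ‖u i ω‖ ^ 2) ν := integrable_sq_norm_cexp_sub_one (hA i)
      have j2 : Integrable (fun ω => ‖w j ω‖ ^ 2) ν := integrable_sq_norm_cexp_sub_one (hB j)
      have j3 : Integrable (fun ω => 2 * (‖u i ω‖ ^ 2 * ‖w j ω‖ ^ 2) / η) ν :=
        ((integrable_sq_norm_mul_sq_norm (hA i) (hB j)).const_mul 2).div_const η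
      have j12 : Integrable (fun ω => η * (‖u i ω‖ ^ 2 + ‖w j ω‖ ^ 2)) ν :=
        (j1.add j2).const_mul η
      rw [integral_add j12 j3, integral_const_mul, integral_add j1 j2, integral_div, integral_const_mul]
      have k1 := integral_sq_norm_cexp_sub_one_le (hA i) (hδA i)
      have k2 := integral_sq_norm_cexp_sub_one_le (hB j) (hδB j)
      have k3 := integral_sq_norm_mul_sq_norm_le (hA i) (hB j) (hδA i) (hδB j) (hD i j) (hD' i j)
      refine add_le_add (mul_le_mul_of_nonneg_left (by linarith) hη.le) ?_
      exact div_le_div_of_nonneg_right (by linarith) hη.le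
    rw [hR, integral_const_mul, integral_finsetSum _ fun i _ =>
      integrable_finsetSum _ fun j _ => iterm i j]
    have : ∑ i, ∫ ω, ∑ j, (η * (‖u i ω‖ ^ 2 + ‖w j ω‖ ^ 2) +
        2 * (‖u i ω‖ ^ 2 * ‖w j ω‖ ^ 2) / η) ∂ν ≤
        ∑ _i : Fin m, ∑ _j : Fin m, (η * (4 * δ) + 8 * (D + δ ^ 2) / η) := by
      refine Finset.sum_le_sum fun i _ => ?_
      rw [integral_finsetSum _ fun j _ => iterm i j]
      exact Finset.sum_le_sum fun j _ => hterm i j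
    refine (mul_le_mul_of_nonneg_left this (Nat.cast_nonneg m)).trans (le_of_eq ?_)
    simp only [Finset.sum_const, Finset.card_univ, Fintype.card_fin, nsmul_eq_mul]
    ring
  have hsum : ‖∫ ω, ∑ i, ∑ j, u i ω * w j ω ∂ν‖ ≤ (m ^ 2 : ℝ) * (D + δ ^ 2) := by
    rw [integral_finsetSum _ fun i _ => integrable_finsetSum _ fun j _ => iuw i j]
    have : ‖∑ i, ∫ ω, ∑ j, u i ω * w j ω ∂ν‖ ≤ ∑ _i : Fin m, ∑ _j : Fin m, (D + δ ^ 2) := by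
      refine norm_sum_le_of_le _ fun i _ => ?_
      rw [integral_finsetSum _ fun j _ => iuw i j]
      exact norm_sum_le_of_le _ fun j _ =>
        norm_integral_cexp_sub_one_mul_le (hA i) (hB j) (hδA i) (hδB j) (hD i j)
    refine this.trans (le_of_eq ?_)
    simp only [Finset.sum_const, Finset.card_univ, Fintype.card_fin, nsmul_eq_mul]
    ring
  have hprod : ‖(expChar ν (fun ω => ∑ i, A i ω) - 1) * (expChar ν (fun ω => ∑ j, B j ω) - 1)‖ ≤
      δ ^ 2 := by
    rw [norm_mul, sq]
    exact mul_le_mul hδA' hδB' (norm_nonneg _) hδ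
  rw [← sub_eq_iff_eq_add] at hmain
  rw [← hmain]
  refine (norm_sub_le _ _).trans (add_le_add ?_ hprod)
  have := norm_le_norm_add_norm_sub' (∫ ω, UW ω ∂ν) (∫ ω, ∑ i, ∑ j, u i ω * w j ω ∂ν)
  linarith

end estimate

theorem isProbabilityMeasure_convPow {E : Type*} [AddMonoid E] [MeasurableSpace E]
    [MeasurableAdd₂ E] (ν : Measure E) [IsProbabilityMeasure ν] (n : ℕ) :
    IsProbabilityMeasure (convPow ν n) := by
  induction n with
  | zero => exact Measure.dirac.isProbabilityMeasure
  | succ n ih => exact Measure.probabilitymeasure_of_probabilitymeasures_conv _ _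

section roots

variable {E : Type*} [NormedAddCommGroup E] [NormedSpace ℝ E] [MeasurableSpace E] [BorelSpace E]
  [SecondCountableTopology E]

theorem expChar_convPow (ν : Measure E) [IsProbabilityMeasure ν] (L : StrongDual ℝ E) (n : ℕ) :
    expChar (convPow ν n) L = expChar ν L ^ n := by
  induction n with
  | zero => simp [convPow, expChar]
  | succ n ih =>
    have := isProbabilityMeasure_convPow ν n
    rw [pow_succ, ← ih]
    exact charFunDual_conv L

theorem IsInfDiv.exists_expChar_root {μ : Measure E} (hμ : IsInfDiv μ) {n : ℕ} (hn : 1 ≤ n) :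
    ∃ ν : Measure E, IsProbabilityMeasure ν ∧
      ∀ L : StrongDual ℝ E, expChar ν L ^ n = expChar μ L := by
  obtain ⟨ν, hν, rfl⟩ := hμ n hn
  exact ⟨ν, hν, fun L => (expChar_convPow ν L n).symm⟩

end roots

theorem integral_comp_eq_of_map_eq {Ω Ω' F G : Type*} [MeasurableSpace Ω] [MeasurableSpace Ω']
    [MeasurableSpace F] [NormedAddCommGroup G] [NormedSpace ℝ G] {μ : Measure Ω} {μ' : Measure Ω'}
    {A : Ω → F} {A' : Ω' → F} (hA : Measurable A) (hA' : Measurable A')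
    (h : μ.map A = μ'.map A') {g : F → G} (hg : StronglyMeasurable g) :
    ∫ ω, g (A ω) ∂μ = ∫ ω, g (A' ω) ∂μ' := by
  rw [← integral_map hA.aemeasurable hg.aestronglyMeasurable, h,
    integral_map hA'.aemeasurable hg.aestronglyMeasurable]

theorem expChar_mul_eq_of_map_eq {Ω Ω' : Type*} [MeasurableSpace Ω] [MeasurableSpace Ω']
    {μ : Measure Ω} {μ' : Measure Ω'} {A : Ω → ℝ} {A' : Ω' → ℝ} (hA : Measurable A)
    (hA' : Measurable A') (h : μ.map A = μ'.map A') (τ : ℝ) :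
    (expChar μ fun ω => τ * A ω) = expChar μ' fun ω => τ * A' ω :=
  integral_comp_eq_of_map_eq (g := fun x : ℝ => cexp ((τ * x : ℝ) * I)) hA hA' h
    (Continuous.stronglyMeasurable (by fun_prop))

section decorrelation

variable {E : Type*} [NormedAddCommGroup E] [NormedSpace ℝ E] [MeasurableSpace E] [BorelSpace E]

/-- Pointwise convergence of the characteristic functions of `a + b` is uniform on `[0, 1]` when
the marginal laws of `a` and `b` are fixed. -/
theorem eventually_norm_expChar_sub_lt {μ : ℕ → Measure E} [∀ k, IsProbabilityMeasure (μ k)]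
    {a b : StrongDual ℝ E} (ha : ∀ k, (μ k).map a = (μ 0).map a)
    (hb : ∀ k, (μ k).map b = (μ 0).map b) {ψ₀ : ℝ → ℂ}
    (hlim : ∀ τ : ℝ, Tendsto (fun k => expChar (μ k) fun x => τ * (a x + b x)) atTop (𝓝 (ψ₀ τ)))
    {ε : ℝ} (hε : 0 < ε) :
    ∀ᶠ k in atTop, ∀ τ ∈ Icc (0 : ℝ) 1, ‖(expChar (μ k) fun x => τ * (a x + b x)) - ψ₀ τ‖ < ε := by
  have ham : Measurable a := a.measurable
  have hbm : Measurable b := b.measurable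
  set F : ℕ → Icc (0 : ℝ) 1 → ℂ := fun k τ => expChar (μ k) fun x => (τ : ℝ) * (a x + b x) with hF
  set G : ℝ → ℝ := fun h => ∫ x, ‖cexp ((h * a x : ℝ) * I) - 1‖ ∂μ 0 +
    ∫ x, ‖cexp ((h * b x : ℝ) * I) - 1‖ ∂μ 0 with hG
  have hGc : Continuous G := (continuous_integral_norm_cexp_sub_one ham).add
    (continuous_integral_norm_cexp_sub_one hbm)
  have hG0 : G 0 = 0 := by simp [hG]
  have hmod (k : ℕ) (σ τ : Icc (0 : ℝ) 1) : dist (F k σ) (F k τ) ≤ G (τ - σ) := by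
    rw [dist_eq_norm]
    refine (norm_expChar_mul_sub_le (ham.add hbm) _ _).trans ?_
    simp only [Pi.add_apply, mul_add]
    refine (integral_norm_cexp_add_sub_one_le (ham.const_mul _) (hbm.const_mul _)).trans
      (le_of_eq ?_)
    have hg : StronglyMeasurable fun y : ℝ => ‖cexp ((((τ : ℝ) - σ) * y : ℝ) * I) - 1‖ :=
      Continuous.stronglyMeasurable (by fun_prop)
    exact congrArg₂ (· + ·) (integral_comp_eq_of_map_eq ham ham (ha k) hg)
      (integral_comp_eq_of_map_eq hbm hbm (hb k) hg)
  have heq : Equicontinuous F := fun σ => by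
    refine Metric.equicontinuousAt_of_continuity_modulus (fun τ : Icc (0 : ℝ) 1 => G (τ - σ)) ?_ F
      (Eventually.of_forall fun τ k => hmod k σ τ)
    have : Continuous fun τ : Icc (0 : ℝ) 1 => G (τ - σ) := by fun_prop
    simpa [hG0] using this.tendsto σ
  have hpi : Tendsto F atTop (𝓝 fun τ : Icc (0 : ℝ) 1 => ψ₀ τ) :=
    tendsto_pi_nhds.2 fun τ => hlim τ
  have hunif := UniformFun.tendsto_iff_tendstoUniformly.1
    ((heq.tendsto_uniformFun_iff_pi _ _).2 hpi)
  filter_upwards [Metric.tendstoUniformly_iff.1 hunif ε hε] with k hk τ hτ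
  have := hk ⟨τ, hτ⟩
  rwa [dist_comm, dist_eq_norm] at this

/-- Asymptotic decorrelation passes to convolution roots of a fixed order. -/
theorem tendsto_norm_charCov_root {μ ν : ℕ → Measure E} [∀ k, IsProbabilityMeasure (μ k)]
    [∀ k, IsProbabilityMeasure (ν k)] {n : ℕ} (hn : n ≠ 0)
    (hν : ∀ k (L : StrongDual ℝ E), expChar (ν k) L ^ n = expChar (μ k) L)
    {a b : StrongDual ℝ E} (ha : ∀ k, (μ k).map a = (μ 0).map a)
    (hb : ∀ k, (μ k).map b = (μ 0).map b)
    (ha0 : ∀ τ : ℝ, (expChar (μ 0) fun x => τ * a x) ≠ 0)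
    (hb0 : ∀ τ : ℝ, (expChar (μ 0) fun x => τ * b x) ≠ 0)
    (hlim : ∀ τ : ℝ, Tendsto (fun k => expChar (μ k) fun x => τ * (a x + b x)) atTop
      (𝓝 ((expChar (μ 0) fun x => τ * a x) * expChar (μ 0) fun x => τ * b x))) :
    Tendsto (fun k => ‖charCov (ν k) a b‖) atTop (𝓝 0) := by
  have ham : Measurable a := a.measurable
  have hbm : Measurable b := b.measurable
  have hroot (k : ℕ) (L : StrongDual ℝ E) (τ : ℝ) :
      (expChar (ν k) fun x => τ * L x) ^ n = expChar (μ k) fun x => τ * L x := hν k (τ • L)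
  have h := tendsto_sub_of_pow_eq hn (ψ := fun k τ => expChar (μ k) fun x => τ * (a x + b x))
    (r := fun k τ => expChar (ν k) fun x => τ * (a x + b x))
    (q := fun k τ => (expChar (ν k) fun x => τ * a x) * expChar (ν k) fun x => τ * b x)
    (ψ₀ := fun τ => (expChar (μ 0) fun x => τ * a x) * expChar (μ 0) fun x => τ * b x)
    ((continuous_expChar_mul ham).mul (continuous_expChar_mul hbm)).continuousOn
    (fun τ _ => mul_ne_zero (ha0 τ) (hb0 τ))
    (fun ε hε => eventually_norm_expChar_sub_lt ha hb hlim hε)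
    (fun k => (continuous_expChar_mul (ham.add hbm)).continuousOn)
    (fun k => ((continuous_expChar_mul ham).mul (continuous_expChar_mul hbm)).continuousOn)
    (fun k τ => hroot k (a + b) τ)
    (fun k τ => by
      rw [mul_pow, hroot, hroot, expChar_mul_eq_of_map_eq ham ham (ha k),
        expChar_mul_eq_of_map_eq hbm hbm (hb k)])
    (fun k => by simp [expChar])
    (fun k => by
      rw [norm_mul]
      exact mul_le_one₀ norm_expChar_le_one (norm_nonneg _) norm_expChar_le_one)
  simpa only [one_mul, charCov] using h

/-- For infinitely divisible laws with fixed marginals, pairwise asymptotic decorrelation of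
linear functionals implies asymptotic decorrelation of their sums. -/
theorem tendsto_expChar_sum_add_sum {m : ℕ} {μ : ℕ → Measure E} [∀ k, IsProbabilityMeasure (μ k)]
    (hroots : ∀ k n, 1 ≤ n → ∃ ν : Measure E, IsProbabilityMeasure ν ∧
      ∀ L : StrongDual ℝ E, expChar ν L ^ n = expChar (μ k) L)
    {A B : Fin m → StrongDual ℝ E} (hA : ∀ k i, (μ k).map (A i) = (μ 0).map (A i))
    (hB : ∀ k j, (μ k).map (B j) = (μ 0).map (B j))
    (hSA : ∀ k, (μ k).map (∑ i, A i : StrongDual ℝ E) = (μ 0).map (∑ i, A i : StrongDual ℝ E))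
    (hSB : ∀ k, (μ k).map (∑ j, B j : StrongDual ℝ E) = (μ 0).map (∑ j, B j : StrongDual ℝ E))
    (hlim : ∀ i j (σ τ : ℝ), Tendsto (fun k => expChar (μ k) fun x => σ * A i x + τ * B j x) atTop
      (𝓝 ((expChar (μ 0) fun x => σ * A i x) * expChar (μ 0) fun x => τ * B j x))) :
    Tendsto (fun k => expChar (μ k) fun x => ∑ i, A i x + ∑ j, B j x) atTop
      (𝓝 ((expChar (μ 0) fun x => ∑ i, A i x) * expChar (μ 0) fun x => ∑ j, B j x)) := by
  have hne (L : StrongDual ℝ E) (τ : ℝ) : (expChar (μ 0) fun x => τ * L x) ≠ 0 :=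
    expChar_ne_zero_of_roots L.measurable (fun n hn => by
      obtain ⟨ν, hν, hνL⟩ := hroots 0 n hn
      exact ⟨ν, hν, fun τ => hνL (τ • L)⟩) τ
  have hbound (L : StrongDual ℝ E) (hL : ∀ k, (μ k).map L = (μ 0).map L) :
      ∃ K : ℝ, 0 ≤ K ∧ ∀ k (n : ℕ), 1 ≤ n → ∀ ν : Measure E, IsProbabilityMeasure ν →
        (∀ L : StrongDual ℝ E, expChar ν L ^ n = expChar (μ k) L) →
        ‖expChar ν L - 1‖ ≤ K / n := by
    obtain ⟨K, hK0, hK⟩ := exists_bound_expChar_root_sub_one L.measurable (hne L)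
    refine ⟨K, hK0, fun k n hn ν hν hνL => hK n hn ν L L.measurable fun τ => ?_⟩
    rw [← expChar_mul_eq_of_map_eq L.measurable L.measurable (hL k)]
    exact hνL (τ • L)
  choose KA hKA0 hKA using fun i => hbound (A i) fun k => hA k i
  choose KB hKB0 hKB using fun j => hbound (B j) fun k => hB k j
  obtain ⟨KSA, hKSA0, hKSA⟩ := hbound _ hSA
  obtain ⟨KSB, hKSB0, hKSB⟩ := hbound _ hSB
  set K : ℝ := ∑ i, KA i + ∑ j, KB j + KSA + KSB with hKdef
  have hsA : 0 ≤ ∑ i, KA i := Finset.sum_nonneg fun i _ => hKA0 i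
  have hsB : 0 ≤ ∑ j, KB j := Finset.sum_nonneg fun j _ => hKB0 j
  have hK0 : 0 ≤ K := by positivity
  have hKA' (i : Fin m) : KA i ≤ K := by
    have := Finset.single_le_sum (fun i _ => hKA0 i) (Finset.mem_univ i)
    linarith
  have hKB' (j : Fin m) : KB j ≤ K := by
    have := Finset.single_le_sum (fun j _ => hKB0 j) (Finset.mem_univ j)
    linarith
  choose ν hν hνL using hroots
  set S : StrongDual ℝ E := ∑ i, A i with hS
  set T : StrongDual ℝ E := ∑ j, B j with hT
  have hSapp : (fun x => ∑ i, A i x) = S := by ext; simp [hS]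
  have hTapp : (fun x => ∑ j, B j x) = T := by ext; simp [hT]
  rw [Metric.tendsto_nhds]
  intro ε hε
  set η : ℝ := ε / (2 * (4 * m ^ 3 * K + 1)) with hη
  have hηpos : 0 < η := by positivity
  set f : ℝ → ℝ → ℝ := fun D t => m ^ 2 * (D / t + K * (K * t)) +
    m ^ 3 * (η * (4 * K) + 8 * (D / t + K * (K * t)) / η) + K * (K * t) with hf
  obtain ⟨n, hn1, hnε⟩ : ∃ n : ℕ, 1 ≤ n ∧ f 0 (n : ℝ)⁻¹ < ε := by
    have hc : Continuous fun t : ℝ => m ^ 2 * (K * (K * t)) +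
      m ^ 3 * (η * (4 * K) + 8 * (K * (K * t)) / η) + K * (K * t) := by fun_prop
    have h0 := (hc.tendsto 0).comp (tendsto_inv_atTop_nhds_zero_nat (𝕜 := ℝ))
    have hlt : m ^ 2 * (K * (K * 0)) +
        m ^ 3 * (η * (4 * K) + 8 * (K * (K * 0)) / η) + K * (K * 0) < ε := by
      have : (m : ℝ) ^ 3 * (η * (4 * K)) = ε / 2 * (4 * m ^ 3 * K / (4 * m ^ 3 * K + 1)) := by
        rw [hη]
        field_simp
      have h1 : 4 * m ^ 3 * K / (4 * m ^ 3 * K + 1) ≤ 1 :=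
        div_le_one_of_le₀ (by linarith) (by positivity)
      simp only [mul_zero, zero_div, add_zero, zero_add]
      rw [this]
      nlinarith
    obtain ⟨n, hn, hn1⟩ := ((h0.eventually_lt_const hlt).and (eventually_ge_atTop 1)).exists
    exact ⟨n, hn1, by simpa [hf] using hn⟩
  have hnpos : (0 : ℝ) < n := Nat.cast_pos.2 hn1
  obtain ⟨D, hDε, hDpos⟩ : ∃ D, f D (n : ℝ)⁻¹ < ε ∧ 0 < D := by
    have hc : Continuous fun D => f D (n : ℝ)⁻¹ := by fun_prop
    exact ((((hc.tendsto 0).mono_left nhdsWithin_le_nhds).eventually_lt_const hnε).and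
      (self_mem_nhdsWithin (s := Ioi (0 : ℝ)))).exists
  have hcov (i j : Fin m) (b : StrongDual ℝ E) (hb : b = B j ∨ b = -B j) :
      Tendsto (fun k => ‖charCov (ν k n hn1) (A i) b‖) atTop (𝓝 0) := by
    have := hν
    obtain ⟨c, rfl⟩ : ∃ c : ℝ, b = c • B j := by
      obtain rfl | rfl := hb
      exacts [⟨1, by simp⟩, ⟨-1, (neg_one_smul ℝ _).symm⟩]
    refine tendsto_norm_charCov_root (by omega) (fun k L => hνL k n hn1 L) (fun k => hA k i)
      (fun k => ?_) (hne _) (hne _) fun τ => ?_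
    · have hc : Measurable fun y : ℝ => c * y := measurable_const_mul c
      have hcomp : ⇑(c • B j) = (fun y : ℝ => c * y) ∘ B j := rfl
      rw [hcomp, ← Measure.map_map hc (B j).measurable, hB, Measure.map_map hc (B j).measurable]
    · have := hlim i j τ (τ * c)
      simpa [mul_add, mul_assoc] using this
  have hev : ∀ᶠ k in atTop, ∀ i j, ‖charCov (ν k n hn1) (A i) (B j)‖ ≤ D ∧
      ‖charCov (ν k n hn1) (A i) fun x => -B j x‖ ≤ D :=
    eventually_all.2 fun i => eventually_all.2 fun j =>
      (((hcov i j _ (Or.inl rfl)).eventually_le_const hDpos).and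
        ((hcov i j _ (Or.inr rfl)).eventually_le_const hDpos))
  filter_upwards [hev] with k hk
  have := hν k n hn1
  have hdiv {x : ℝ} (hx : x ≤ K) : x / n ≤ K / n := div_le_div_of_nonneg_right hx hnpos.le
  have hmain := norm_charCov_sum_le (ν := ν k n hn1) (A := fun i => A i) (B := fun j => B j)
    (fun i => (A i).measurable) (fun j => (B j).measurable) (δ := K / n) (D := D) hηpos
    (fun i => (hKA i k n hn1 _ (hν k n hn1) (hνL k n hn1)).trans (hdiv (hKA' i)))
    (fun j => (hKB j k n hn1 _ (hν k n hn1) (hνL k n hn1)).trans (hdiv (hKB' j)))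
    (by
      rw [hSapp]
      exact (hKSA k n hn1 _ (hν k n hn1) (hνL k n hn1)).trans (hdiv (by linarith)))
    (by
      rw [hTapp]
      exact (hKSB k n hn1 _ (hν k n hn1) (hνL k n hn1)).trans (hdiv (by linarith)))
    (fun i j => (hk i j).1) (fun i j => (hk i j).2)
  have hpow := norm_pow_sub_pow_le_of_norm_le_one (n := n)
    (x := expChar (ν k n hn1) (S + T : StrongDual ℝ E))
    (y := expChar (ν k n hn1) S * expChar (ν k n hn1) T) norm_expChar_le_one (by
      rw [norm_mul]
      exact mul_le_one₀ norm_expChar_le_one (norm_nonneg _) norm_expChar_le_one)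
  have hSk := expChar_mul_eq_of_map_eq S.measurable S.measurable (hSA k) 1
  have hTk := expChar_mul_eq_of_map_eq T.measurable T.measurable (hSB k) 1
  simp only [one_mul] at hSk hTk
  rw [mul_pow, hνL, hνL, hνL, hSk, hTk] at hpow
  have hsum : (fun x => ∑ i, A i x + ∑ j, B j x) = (S + T : StrongDual ℝ E) := by
    ext; simp [hS, hT]
  rw [hsum, hSapp, hTapp, dist_eq_norm]
  rw [hSapp, hTapp] at hmain
  refine hpow.trans_lt (lt_of_le_of_lt ?_ hDε)
  refine (mul_le_mul_of_nonneg_left hmain hnpos.le).trans (le_of_eq ?_)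
  simp only [hf]
  field_simp

end decorrelation

theorem expChar_map {Ω F : Type*} [MeasurableSpace Ω] [MeasurableSpace F] {μ : Measure Ω}
    {Y : Ω → F} (hY : Measurable Y) {A : F → ℝ} (hA : Measurable A) :
    expChar (μ.map Y) A = expChar μ fun ω => A (Y ω) :=
  integral_map hY.aemeasurable
    (show Measurable fun y => cexp (A y * I) by fun_prop).aestronglyMeasurable

/-- Lévy's convergence theorem on `Fin d → ℝ`. -/
theorem tendsto_probabilityMeasure_iff_tendsto_expChar {d : ℕ}
    {μ : ℕ → ProbabilityMeasure (Fin d → ℝ)} {μ₀ : ProbabilityMeasure (Fin d → ℝ)} :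
    Tendsto μ atTop (𝓝 μ₀) ↔ ∀ θ : Fin d → ℝ,
      Tendsto (fun n => expChar (μ n : Measure (Fin d → ℝ)) fun x => ∑ k, θ k * x k) atTop
        (𝓝 (expChar (μ₀ : Measure (Fin d → ℝ)) fun x => ∑ k, θ k * x k)) := by
  constructor
  · intro h θ
    rw [ProbabilityMeasure.tendsto_iff_forall_integral_rclike_tendsto ℂ] at h
    exact h (BoundedContinuousFunction.ofNormedAddCommGroup
      (fun x : Fin d → ℝ => cexp ((∑ k, θ k * x k : ℝ) * I)) (by fun_prop) 1
      fun x => (norm_exp_ofReal_mul_I _).le)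
  · intro h
    have hto : Continuous (WithLp.toLp 2 : (Fin d → ℝ) → EuclideanSpace ℝ (Fin d)) :=
      PiLp.continuous_toLp 2 _
    have hof : Continuous (WithLp.ofLp : EuclideanSpace ℝ (Fin d) → Fin d → ℝ) :=
      PiLp.continuous_ofLp 2 _
    have hchar (ν : ProbabilityMeasure (Fin d → ℝ)) (t : EuclideanSpace ℝ (Fin d)) :
        charFun ((ν.map hto.measurable.aemeasurable : ProbabilityMeasure _) :
          Measure (EuclideanSpace ℝ (Fin d))) t =
          expChar (ν : Measure (Fin d → ℝ)) fun x => ∑ k, t k * x k := by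
      rw [charFun_apply, ProbabilityMeasure.toMeasure_map, integral_map hto.measurable.aemeasurable
        (by fun_prop)]
      rfl
    have h1 : Tendsto (fun n => (μ n).map hto.measurable.aemeasurable) atTop
        (𝓝 (μ₀.map hto.measurable.aemeasurable)) := by
      refine ProbabilityMeasure.tendsto_of_tendsto_charFun fun t => ?_
      simp_rw [hchar]
      exact h t
    have h2 := ProbabilityMeasure.tendsto_map_of_tendsto_of_continuous _ _ h1 hof
    have hback (ν : ProbabilityMeasure (Fin d → ℝ)) :
        (ν.map hto.measurable.aemeasurable).map hof.measurable.aemeasurable = ν := by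
      apply Subtype.ext
      simp only [ProbabilityMeasure.toMeasure_map, ProbabilityMeasure.val_eq_to_measure]
      rw [Measure.map_map hof.measurable hto.measurable]
      exact Measure.map_id
    simpa only [hback] using h2

/-- If a sequence of characters with constant mean is asymptotically pairwise uncorrelated, it is
asymptotically uncorrelated with every fixed character. -/
theorem tendsto_expChar_add_of_tendsto_expChar_sub {Ω : Type*} [MeasurableSpace Ω] {P : Measure Ω}
    [IsProbabilityMeasure P] {Z : ℕ → Ω → ℝ} (hZ : ∀ n, Measurable (Z n)) {c : ℂ}
    (hc : ∀ n, expChar P (Z n) = c)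
    (hlim : ∀ m, Tendsto (fun n => expChar P fun ω => Z n ω - Z m ω) atTop
      (𝓝 (c * (starRingEnd ℂ) c)))
    {W : Ω → ℝ} (hW : Measurable W) :
    Tendsto (fun n => expChar P fun ω => W ω + Z n ω) atTop (𝓝 (expChar P W * c)) := by
  have hmem {U : Ω → ℝ} (hU : Measurable U) : MemLp (fun ω => cexp (U ω * I)) 2 P :=
    MemLp.of_bound (by fun_prop) 1 (Eventually.of_forall fun ω => (norm_exp_ofReal_mul_I _).le)
  have hinner {U V : Ω → ℝ} (hU : Measurable U) (hV : Measurable V) :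
      inner ℂ ((hmem hU).toLp _) ((hmem hV).toLp _) = expChar P fun ω => V ω - U ω := by
    rw [L2.inner_def]
    refine integral_congr_ae ?_
    filter_upwards [(hmem hU).coeFn_toLp, (hmem hV).coeFn_toLp] with ω h1 h2
    rw [h1, h2, RCLike.inner_apply, ← exp_conj, ← Complex.exp_add]
    congr 1
    simp only [map_mul, conj_ofReal, conj_I]
    push_cast
    ring
  obtain ⟨f, hf⟩ : ∃ f : {U : Ω → ℝ // Measurable U} → Lp ℂ 2 P,
      ∀ U V, inner ℂ (f U) (f V) = expChar P fun ω => V.1 ω - U.1 ω :=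
    ⟨fun U => (hmem U.2).toLp _, fun U V => hinner U.2 V.2⟩
  set v : ℕ → Lp ℂ 2 P := fun n => f ⟨Z n, hZ n⟩ - c • f ⟨fun _ => 0, measurable_const⟩ with hv
  have h00 : (expChar P fun _ => (0 : ℝ)) = 1 := by simp [expChar]
  have hvv (m n : ℕ) : inner ℂ (v m) (v n) =
      (expChar P fun ω => Z n ω - Z m ω) - c * (starRingEnd ℂ) c := by
    simp only [hv, inner_sub_left, inner_sub_right, inner_smul_left, inner_smul_right, hf,
      sub_zero, zero_sub, expChar_neg, hc, h00]
    ring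
  have hbound (n : ℕ) : ‖v n‖ ≤ 1 := by
    have h1 := inner_self_eq_norm_sq (𝕜 := ℂ) (v n)
    rw [hvv] at h1
    simp only [sub_self, h00, mul_conj, RCLike.re_to_complex, sub_re, one_re, ofReal_re] at h1
    nlinarith [norm_nonneg (v n), normSq_nonneg c]
  have key := tendsto_inner_zero_of_asymptotically_orthogonal hbound (fun m => by
    simp_rw [hvv]
    simpa using (hlim m).sub_const (c * (starRingEnd ℂ) c)) (f ⟨fun ω => -W ω, hW.neg⟩)
  simp only [hv, inner_sub_right, inner_smul_right, hf, sub_neg_eq_add, zero_add] at key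
  have := key.add_const (c * expChar P W)
  simpa [add_comm, mul_comm] using this

section field

variable {Ω : Type*} [MeasurableSpace Ω] {l d : ℕ} {P : Measure Ω}
  {X : (Fin l → ℝ) → Ω → (Fin d → ℝ)}

theorem measurable_path (hmeas : ∀ t, Measurable (X t)) {m : ℕ} (t : Fin m → Fin l → ℝ) :
    Measurable fun ω (j : Fin m) => X (t j) ω :=
  measurable_pi_lambda _ fun j => hmeas (t j)

theorem IsStationaryField.map_shift (hstat : IsStationaryField P X)
    (hmeas : ∀ t, Measurable (X t)) {m : ℕ} (t : Fin m → Fin l → ℝ) (h : Fin l → ℝ)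
    {g : (Fin m → Fin d → ℝ) → ℝ} (hg : Measurable g) :
    P.map (fun ω => g fun j => X (t j + h) ω) = P.map fun ω => g fun j => X (t j) ω := by
  have h1 := congrArg (Measure.map g) (hstat h m t)
  rwa [Measure.map_map hg (measurable_path hmeas _), Measure.map_map hg (measurable_path hmeas _)]
    at h1

theorem IsStationaryField.expChar_shift (hstat : IsStationaryField P X)
    (hmeas : ∀ t, Measurable (X t)) {m : ℕ} (t : Fin m → Fin l → ℝ) (h : Fin l → ℝ)
    {g : (Fin m → Fin d → ℝ) → ℝ} (hg : Measurable g) :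
    (expChar P fun ω => g fun j => X (t j + h) ω) = expChar P fun ω => g fun j => X (t j) ω := by
  rw [← expChar_map (measurable_path hmeas _) hg, hstat, expChar_map (measurable_path hmeas _) hg]

/-- Asymptotic independence of the increments `X (t n) - X 0` decorrelates the field at two
arbitrary sites. -/
theorem IsStationaryField.tendsto_expChar_pair [IsProbabilityMeasure P]
    (hstat : IsStationaryField P X) (hmeas : ∀ t, Measurable (X t))
    (hinc : ∀ t : ℕ → (Fin l → ℝ), Tendsto (fun n => ‖t n‖) atTop atTop → ∀ θ : Fin d → ℝ,
      Tendsto (fun n => expChar P fun ω => ∑ k, θ k * (X (t n) ω k - X 0 ω k)) atTop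
        (𝓝 ((expChar P fun ω => ∑ k, θ k * X 0 ω k) *
          (starRingEnd ℂ) (expChar P fun ω => ∑ k, θ k * X 0 ω k))))
    (s p : Fin l → ℝ) (α β : Fin d → ℝ) {t : ℕ → (Fin l → ℝ)}
    (ht : Tendsto (fun n => ‖t n‖) atTop atTop) :
    Tendsto (fun n => expChar P fun ω => ∑ k, α k * X s ω k + ∑ k, β k * X (p + t n) ω k) atTop
      (𝓝 ((expChar P fun ω => ∑ k, α k * X s ω k) *
        expChar P fun ω => ∑ k, β k * X p ω k)) := by
  have hone (q h : Fin l → ℝ) : (expChar P fun ω => ∑ k, β k * X (q + h) ω k) =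
      expChar P fun ω => ∑ k, β k * X q ω k :=
    hstat.expChar_shift hmeas (fun _ : Fin 1 => q) h (g := fun x => ∑ k, β k * x 0 k)
      (by fun_prop)
  have hp : (expChar P fun ω => ∑ k, β k * X p ω k) = expChar P fun ω => ∑ k, β k * X 0 ω k := by
    simpa using hone 0 p
  refine tendsto_expChar_add_of_tendsto_expChar_sub (Z := fun n ω => ∑ k, β k * X (p + t n) ω k)
    (fun n => by fun_prop) (fun n => hone p (t n)) (fun m => ?_) (by fun_prop)
  have hdiff (n : ℕ) : (expChar P fun ω => ∑ k, β k * X (p + t n) ω k -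
      ∑ k, β k * X (p + t m) ω k) =
      expChar P fun ω => ∑ k, β k * (X (t n - t m) ω k - X 0 ω k) := by
    have := hstat.expChar_shift hmeas ![t n - t m, 0] (p + t m)
      (g := fun x => ∑ k, β k * (x 0 k - x 1 k)) (by fun_prop)
    simp only [Matrix.cons_val_zero, Matrix.cons_val_one, zero_add] at this
    rw [← this, show t n - t m + (p + t m) = p + t n by abel]
    simp only [mul_sub, Finset.sum_sub_distrib]
  have htm : Tendsto (fun n => ‖t n - t m‖) atTop atTop :=
    tendsto_atTop_mono (fun n => norm_sub_norm_le (t n) (t m))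
      (tendsto_atTop_add_const_right _ (-‖t m‖) ht)
  simp_rw [hdiff, hp]
  exact hinc _ htm β

end field

section field

variable {Ω : Type*} [MeasurableSpace Ω] {l d : ℕ} {P : Measure Ω} [IsProbabilityMeasure P]
  {X : (Fin l → ℝ) → Ω → (Fin d → ℝ)}

theorem expChar_map_sub_prod (ρ : Measure (Fin d → ℝ)) [IsProbabilityMeasure ρ]
    (θ : Fin d → ℝ) :
    (expChar ((ρ.prod ρ).map fun q : (Fin d → ℝ) × (Fin d → ℝ) => q.1 - q.2)
      fun x => ∑ k, θ k * x k) =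
      (expChar ρ fun x => ∑ k, θ k * x k) *
        (starRingEnd ℂ) (expChar ρ fun x => ∑ k, θ k * x k) := by
  rw [expChar_map (by fun_prop) (by fun_prop), ← expChar_neg, expChar, expChar, expChar,
    ← integral_prod_mul]
  congr with q
  rw [← Complex.exp_add, ← add_mul, ← ofReal_add]
  simp only [Pi.sub_apply, mul_sub, Finset.sum_sub_distrib]
  rw [sub_eq_add_neg]

/-- Weak convergence of the increments to the symmetrised marginal law, in terms of
characteristic functions. -/
theorem tendsto_increment_iff_tendsto_expChar (hmeas : ∀ t, Measurable (X t))
    (t : ℕ → (Fin l → ℝ)) :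
    (∀ f : BoundedContinuousFunction (Fin d → ℝ) ℝ,
      Tendsto (fun n => ∫ x, f x ∂(P.map (fun ω => X (t n) ω - X 0 ω))) atTop
        (𝓝 (∫ x, f x ∂(Measure.map (fun q : (Fin d → ℝ) × (Fin d → ℝ) => q.1 - q.2)
          ((P.map (X 0)).prod (P.map (X 0))))))) ↔
    ∀ θ : Fin d → ℝ,
      Tendsto (fun n => expChar P fun ω => ∑ k, θ k * (X (t n) ω k - X 0 ω k)) atTop
        (𝓝 ((expChar P fun ω => ∑ k, θ k * X 0 ω k) *
          (starRingEnd ℂ) (expChar P fun ω => ∑ k, θ k * X 0 ω k))) := by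
  have hdiff (n : ℕ) : Measurable fun ω => X (t n) ω - X 0 ω := (hmeas _).sub (hmeas _)
  have hsub : Measurable fun q : (Fin d → ℝ) × (Fin d → ℝ) => q.1 - q.2 := by fun_prop
  have hprob : IsProbabilityMeasure (P.map (X 0)) :=
    Measure.isProbabilityMeasure_map (hmeas 0).aemeasurable
  set μ : ℕ → ProbabilityMeasure (Fin d → ℝ) := fun n =>
    ⟨P.map (fun ω => X (t n) ω - X 0 ω),
      Measure.isProbabilityMeasure_map (hdiff n).aemeasurable⟩ with hμ
  set μ₀ : ProbabilityMeasure (Fin d → ℝ) :=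
    ⟨((P.map (X 0)).prod (P.map (X 0))).map fun q => q.1 - q.2,
      Measure.isProbabilityMeasure_map hsub.aemeasurable⟩ with hμ₀
  refine (ProbabilityMeasure.tendsto_iff_forall_integral_tendsto (μs := μ) (μ := μ₀)).symm.trans
    (tendsto_probabilityMeasure_iff_tendsto_expChar.trans (forall_congr' fun θ => ?_))
  have hlin : Measurable fun x : Fin d → ℝ => ∑ k, θ k * x k := by fun_prop
  have h1 (n : ℕ) : (expChar (μ n : Measure (Fin d → ℝ)) fun x => ∑ k, θ k * x k) =
      expChar P fun ω => ∑ k, θ k * (X (t n) ω k - X 0 ω k) := expChar_map (hdiff n) hlin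
  have h2 : (expChar (μ₀ : Measure (Fin d → ℝ)) fun x => ∑ k, θ k * x k) = _ :=
    expChar_map_sub_prod (P.map (X 0)) θ
  rw [expChar_map (hmeas 0) hlin] at h2
  simp only [h1, h2]

theorem IsIDField.tendsto_expChar_sum_add_sum (hID : IsIDField P X)
    (hstat : IsStationaryField P X) (hmeas : ∀ t, Measurable (X t)) {t : ℕ → (Fin l → ℝ)}
    (hpair : ∀ (s p : Fin l → ℝ) (α β : Fin d → ℝ),
      Tendsto (fun n => expChar P fun ω => ∑ k, α k * X s ω k + ∑ k, β k * X (p + t n) ω k) atTop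
        (𝓝 ((expChar P fun ω => ∑ k, α k * X s ω k) *
          expChar P fun ω => ∑ k, β k * X p ω k)))
    {m : ℕ} (s p : Fin m → Fin l → ℝ) (θ₁ θ₂ : Fin m → Fin d → ℝ) :
    Tendsto (fun n => expChar P fun ω => ∑ j, ∑ k, θ₁ j k * X (s j) ω k +
        ∑ j, ∑ k, θ₂ j k * X (p j + t n) ω k) atTop
      (𝓝 ((expChar P fun ω => ∑ j, ∑ k, θ₁ j k * X (s j) ω k) *
        expChar P fun ω => ∑ j, ∑ k, θ₂ j k * X (p j) ω k)) := by
  set T : ℕ → Fin (m + m) → Fin l → ℝ := fun n => Fin.append s fun j => p j + t n with hT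
  set Y : ℕ → Ω → Fin (m + m) → Fin d → ℝ := fun n ω j => X (T n j) ω with hY
  have hYm (n : ℕ) : Measurable (Y n) := measurable_path hmeas (T n)
  set μ : ℕ → Measure (Fin (m + m) → Fin d → ℝ) := fun n => P.map (Y n) with hμ
  have hprob (n : ℕ) : IsProbabilityMeasure (μ n) :=
    Measure.isProbabilityMeasure_map (hYm n).aemeasurable
  let ev (i : Fin (m + m)) (k : Fin d) : StrongDual ℝ (Fin (m + m) → Fin d → ℝ) :=
    (ContinuousLinearMap.proj k).comp
      (ContinuousLinearMap.proj (R := ℝ) (φ := fun _ : Fin (m + m) => Fin d → ℝ) i)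
  set A : Fin m → StrongDual ℝ (Fin (m + m) → Fin d → ℝ) :=
    fun i => ∑ k, θ₁ i k • ev (Fin.castAdd m i) k with hA
  set B : Fin m → StrongDual ℝ (Fin (m + m) → Fin d → ℝ) :=
    fun j => ∑ k, θ₂ j k • ev (Fin.natAdd m j) k with hB
  have hAY (n : ℕ) (i : Fin m) (ω : Ω) : A i (Y n ω) = ∑ k, θ₁ i k * X (s i) ω k := by
    simp [hA, hY, hT, ev]
  have hBY (n : ℕ) (j : Fin m) (ω : Ω) : B j (Y n ω) = ∑ k, θ₂ j k * X (p j + t n) ω k := by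
    simp [hB, hY, hT, ev, -Fin.natAdd_eq_addNat]
  have hmap (L : StrongDual ℝ (Fin (m + m) → Fin d → ℝ)) (n : ℕ) :
      (μ n).map L = P.map fun ω => L (Y n ω) := Measure.map_map L.measurable (hYm n)
  have key := _root_.tendsto_expChar_sum_add_sum (μ := μ) (A := A) (B := B)
    (fun k n hn => (hID (m + m) (T k)).exists_expChar_root hn)
    (fun k i => by simp only [hmap, hAY])
    (fun k j => by
      simp only [hmap, hBY]
      rw [hstat.map_shift hmeas p (t k) (g := fun x => ∑ k, θ₂ j k * x j k) (by fun_prop),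
        hstat.map_shift hmeas p (t 0) (g := fun x => ∑ k, θ₂ j k * x j k) (by fun_prop)])
    (fun k => by simp only [hmap, _root_.sum_apply, hAY])
    (fun k => by
      simp only [hmap, _root_.sum_apply, hBY]
      rw [hstat.map_shift hmeas p (t k) (g := fun x => ∑ j, ∑ k, θ₂ j k * x j k) (by fun_prop),
        hstat.map_shift hmeas p (t 0) (g := fun x => ∑ j, ∑ k, θ₂ j k * x j k) (by fun_prop)])
    (fun i j σ τ => by
      have hE (n : ℕ) : (expChar (μ n) fun x => σ * A i x + τ * B j x) =
          expChar P fun ω => σ * A i (Y n ω) + τ * B j (Y n ω) :=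
        expChar_map (hYm n) (((A i).measurable.const_mul σ).add ((B j).measurable.const_mul τ))
      simp only [hE]
      simp only [hμ]
      rw [expChar_map (hYm 0) ((A i).measurable.const_mul σ),
        expChar_map (hYm 0) ((B j).measurable.const_mul τ)]
      simp only [hAY, hBY]
      rw [hstat.expChar_shift hmeas p (t 0) (g := fun x => τ * ∑ k, θ₂ j k * x j k) (by fun_prop)]
      simpa only [Pi.smul_apply, smul_eq_mul, mul_assoc, ← Finset.mul_sum] using
        hpair (s i) (p j) (σ • θ₁ i) (τ • θ₂ j))
  have hSA : Measurable fun x => ∑ i, A i x :=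
    Finset.measurable_fun_sum _ fun i _ => (A i).measurable
  have hSB : Measurable fun x => ∑ j, B j x :=
    Finset.measurable_fun_sum _ fun j _ => (B j).measurable
  have hE (n : ℕ) : (expChar (μ n) fun x => ∑ i, A i x + ∑ j, B j x) =
      expChar P fun ω => ∑ i, A i (Y n ω) + ∑ j, B j (Y n ω) :=
    expChar_map (hYm n) (hSA.add hSB)
  simp only [hE] at key
  simp only [hμ] at key
  rw [expChar_map (hYm 0) hSA, expChar_map (hYm 0) hSB] at key
  simp only [hAY, hBY] at key
  rwa [hstat.expChar_shift hmeas p (t 0) (g := fun x => ∑ j, ∑ k, θ₂ j k * x j k)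
    (by fun_prop)] at key

end field

end

/-- A strictly stationary infinitely divisible random field is mixing
if and only if, along every sequence `t_n` with `‖t_n‖_∞ → ∞`, the law of
`X_{t_n} - X_0` converges weakly to the law of `X_0 - X_0'`, where `X_0'` is an
independent copy of `X_0`. -/
theorem stmt_1 {Ω : Type*} [MeasurableSpace Ω] {l d : ℕ} (P : Measure Ω)
    [IsProbabilityMeasure P] (X : (Fin l → ℝ) → Ω → (Fin d → ℝ))
    (hmeas : ∀ t, Measurable (X t))
    (hstat : IsStationaryField P X) (hID : IsIDField P X) :
    IsMixingField P X ↔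
      ∀ t : ℕ → (Fin l → ℝ), Tendsto (fun n => ‖t n‖) atTop atTop →
        ∀ f : BoundedContinuousFunction (Fin d → ℝ) ℝ,
          Tendsto (fun n => ∫ x, f x ∂(P.map (fun ω => X (t n) ω - X 0 ω))) atTop
            (nhds (∫ x, f x ∂(Measure.map (fun q : (Fin d → ℝ) × (Fin d → ℝ) => q.1 - q.2)
              ((P.map (X 0)).prod (P.map (X 0)))))) := by
  simp_rw [tendsto_increment_iff_tendsto_expChar hmeas]
  constructor
  · intro hmix t ht θ
    have h := hmix 1 (fun _ => 0) (fun _ => 0) (fun _ => -θ) (fun _ => θ) t ht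
    simp only [mul_comm Complex.I, Finset.univ_unique, Finset.sum_singleton, zero_add] at h
    rw [← expChar_neg, mul_comm]
    convert h using 2
    · refine congrArg (expChar P) (funext fun ω => ?_)
      simp only [mul_sub, Finset.sum_sub_distrib, Pi.neg_apply, neg_mul, Finset.sum_neg_distrib]
      ring
    · simp only [expChar, Pi.neg_apply, neg_mul, Finset.sum_neg_distrib]
  · intro hinc m s p θ₁ θ₂ t ht
    simp only [mul_comm Complex.I]
    exact hID.tendsto_expChar_sum_add_sum hstat hmeas
      (fun s p α β => hstat.tendsto_expChar_pair hmeas hinc s p α β ht) s p θ₁ θ₂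

end
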